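/- Fix ε > 0 and ε' > 0. Then there is a constant c₃ > 0, depending only on ε, ε' and b (one may take c₃ = min(ε², ε'²)/(4 log b)), such that for every Δ ∈ [0,1) and every real y with ε' ≤ y ≤ Δ − x₀ − ε, one has φ(Δ − y) ≤ −c₃. -/

import Mathlib

/-- `φ(x) = (1−Δ+x) log_b(1−Δ+x) + (1−Δ)(Δ−x)/2`, where `log_b y = log y / log b`
(`Real.logb`), and `0 · log_b 0` is interpreted as `0` (automatic, since `Real.log 0 = 0`). -/
noncomputable def phiFun (b Δ x : ℝ) : ℝ :=
  (1 - Δ + x) * Real.logb b (1 - Δ + x) + (1 - Δ) * (Δ - x) / 2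

/-- `x₀`: the smallest nonnegative solution `x` of `φ(x) ≤ 0`. -/
noncomputable def xZero (b Δ : ℝ) : ℝ := sInf {x : ℝ | 0 ≤ x ∧ phiFun b Δ x ≤ 0}

/-- `t ↦ t log t - t² / 2` is convex on `[0, 1]`; that is, `t log t` is `1`-strongly convex there. -/
lemma convexOn_mul_log_sub_sq :
    ConvexOn ℝ (Set.Icc (0 : ℝ) 1) (fun t => t * Real.log t - t ^ 2 / 2) := by
  have hd : ∀ t : ℝ, 0 < t →
      HasDerivAt (fun t : ℝ => t * Real.log t - t ^ 2 / 2) (Real.log t + 1 - t) t := by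
    intro t ht
    exact ((Real.hasDerivAt_mul_log ht.ne').sub ((hasDerivAt_pow 2 t).div_const 2)).congr_deriv
      (by norm_num)
  refine MonotoneOn.convexOn_of_deriv (convex_Icc 0 1) ?_ ?_ ?_
  · exact (Real.continuous_mul_log.sub (by fun_prop)).continuousOn
  · rw [interior_Icc]
    exact fun t ht => (hd t ht.1).differentiableAt.differentiableWithinAt
  · rw [interior_Icc]
    intro s hs t ht hst
    rw [(hd s hs.1).deriv, (hd t ht.1).deriv]
    have hlog := Real.log_le_sub_one_of_pos (div_pos hs.1 ht.1)
    rw [Real.log_div hs.1.ne' ht.1.ne'] at hlog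
    have hdiv : s / t ≤ 1 - (t - s) := by
      rw [div_le_iff₀ ht.1]
      nlinarith [mul_nonneg (sub_nonneg.2 hst) (sub_nonneg.2 ht.2.le)]
    linarith

lemma continuous_phiFun (b Δ : ℝ) : Continuous (phiFun b Δ) := by
  have h : phiFun b Δ = fun x =>
      (1 - Δ + x) * Real.log (1 - Δ + x) / Real.log b + (1 - Δ) * (Δ - x) / 2 := by
    funext x
    simp only [phiFun, Real.logb, mul_div_assoc]
  rw [h]
  have hc : Continuous fun x : ℝ => (1 - Δ + x) * Real.log (1 - Δ + x) :=
    Real.continuous_mul_log.comp (by fun_prop : Continuous fun x : ℝ => 1 - Δ + x)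
  exact (hc.div_const _).add (by fun_prop)

/-- The infimum defining `xZero` is attained. -/
lemma xZero_mem {b Δ : ℝ} (hΔ : 0 ≤ Δ) : 0 ≤ xZero b Δ ∧ phiFun b Δ (xZero b Δ) ≤ 0 := by
  have hclosed : IsClosed {x : ℝ | 0 ≤ x ∧ phiFun b Δ x ≤ 0} :=
    (isClosed_le continuous_const continuous_id).inter
      (isClosed_le (continuous_phiFun b Δ) continuous_const)
  exact hclosed.csInf_mem ⟨Δ, hΔ, by simp [phiFun]⟩ ⟨0, fun _ hx => hx.1⟩

/-- Quadratic upper bound for `φ` between a point where `φ ≤ 0` and its zero `Δ`. -/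
lemma phiFun_le_of_nonpos {b Δ z y : ℝ} (hb : 1 < b) (hΔ : Δ < 1) (hz : 0 ≤ z)
    (hφ : phiFun b Δ z ≤ 0) (hy : 0 < y) (hyz : y ≤ Δ - z) :
    phiFun b Δ (Δ - y) ≤ -(y * (Δ - z - y) / (2 * Real.log b)) := by
  have hL : 0 < Real.log b := Real.log_pos hb
  have hd : 0 < Δ - z := hy.trans_le hyz
  obtain ⟨l, hl⟩ : ∃ l, l = y / (Δ - z) := ⟨_, rfl⟩
  have hly : l * (Δ - z) = y := by rw [hl, div_mul_cancel₀ _ hd.ne']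
  have hl0 : 0 ≤ l := by rw [hl]; positivity
  have hl1 : l ≤ 1 := by rw [hl]; exact (div_le_one hd).2 hyz
  have key := convexOn_mul_log_sub_sq.2 (x := 1 - Δ + z) (y := 1)
    ⟨by linarith, by linarith⟩ ⟨by norm_num, le_rfl⟩ hl0 (sub_nonneg.2 hl1) (by ring)
  have hu : l * (1 - Δ + z) + (1 - l) * 1 = 1 - Δ + (Δ - y) := by linear_combination -hly
  simp only [smul_eq_mul, hu, Real.log_one] at key
  have hmul : ∀ x, phiFun b Δ x * Real.log b =
      (1 - Δ + x) * Real.log (1 - Δ + x) + (1 - Δ) * (Δ - x) / 2 * Real.log b := by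
    intro x
    unfold phiFun Real.logb
    field_simp
  have hz' : l * (phiFun b Δ z * Real.log b) ≤ 0 :=
    mul_nonpos_of_nonneg_of_nonpos hl0 (mul_nonpos_of_nonpos_of_nonneg hφ hL.le)
  rw [hmul] at hz'
  rw [← neg_div, le_div_iff₀ (by positivity)]
  have hx := hmul (Δ - y)
  subst hly
  nlinarith

/-- **(11) Lemma 3.5.** Fix `ε > 0` and `ε' > 0`.  Then there is a constant `c₃ > 0`,
depending only on `ε`, `ε'` and `b`, such that for every `Δ ∈ [0,1)` and every real `y`
with `ε' ≤ y ≤ Δ − x₀ − ε`, one has `φ(Δ − y) ≤ −c₃`. -/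
theorem phi_upper_bound_middle
    (b : ℝ) (hb : 1 < b) (ε ε' : ℝ) (hε : 0 < ε) (hε' : 0 < ε') :
    ∃ c₃ > (0 : ℝ), ∀ Δ ∈ Set.Ico (0 : ℝ) 1, ∀ y : ℝ,
      ε' ≤ y → y ≤ Δ - xZero b Δ - ε → phiFun b Δ (Δ - y) ≤ -c₃ := by
  have hL : 0 < Real.log b := Real.log_pos hb
  refine ⟨ε' * ε / (2 * Real.log b), by positivity, fun Δ hΔ y hy hyε => ?_⟩
  obtain ⟨hz, hφ⟩ := xZero_mem (b := b) hΔ.1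
  refine (phiFun_le_of_nonpos hb hΔ.2 hz hφ (hε'.trans_le hy) (by linarith)).trans ?_
  have hy0 : 0 ≤ y := hε'.le.trans hy
  have hgap : ε ≤ Δ - xZero b Δ - y := by linarith
  gcongr
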